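/- arXiv:1309.3762 — 2 statements merged into one kernel-verified Lean document; each statement's English description precedes it below -/
import Mathlib

section
/- Let Q be the quiver of type D₄ with vertices x, y, z, t and three arrows ᾱ : x → t, η̄ : z → t, γ̄ : y → t, and let M be the representation of Q with M_x = M_y = M_z = ℂ², M_t = ℂ³, M_ᾱ(x₀, x₁) = (x₀, x₁, 0), M_η̄(z₀, z₁) = (0, z₀, z₁) and M_γ̄(y₀, y₁) = (y₀, 0, y₁). Then the map N ↦ (N_x, N_y, N_z) is a bijection from the set of subrepresentations N of M with dim N_x = dim N_y = dim N_z = 1 and dim N_t = 2 onto the set of triples (L_x, L_y, L_z) of one-dimensional subspaces of ℂ² such that x₀·y₁·z₀ + x₁·y₀·z₁ = 0 for some (equivalently every) choice of nonzero vectors (x₀, x₁) ∈ L_x, (y₀, y₁) ∈ L_y and (z₀, z₁) ∈ L_z. -/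
/-- The hypersurface condition on a triple of lines in `ℂ²`: for every choice of nonzero
vectors `(x₀,x₁) ∈ L_x`, `(y₀,y₁) ∈ L_y`, `(z₀,z₁) ∈ L_z` one has
`x₀·y₁·z₀ + x₁·y₀·z₁ = 0`. -/
def DelPezzoCond (Lx Ly Lz : Submodule ℂ (ℂ × ℂ)) : Prop :=
  ∀ vx ∈ Lx, ∀ vy ∈ Ly, ∀ vz ∈ Lz, vx ≠ 0 → vy ≠ 0 → vz ≠ 0 →
    vx.1 * vy.2 * vz.1 + vx.2 * vy.1 * vz.2 = 0

lemma dp_indep_iff (x y z : ℂ × ℂ) (hx : x ≠ 0) (hy : y ≠ 0) (hz : z ≠ 0) :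
    LinearIndependent ℂ ![((x.1, x.2, 0) : ℂ × ℂ × ℂ), (y.1, 0, y.2), (0, z.1, z.2)] ↔
      x.1 * y.2 * z.1 + x.2 * y.1 * z.2 ≠ 0 := by
  obtain ⟨a, b⟩ := x
  obtain ⟨c, d⟩ := y
  obtain ⟨e, f⟩ := z
  simp only [ne_eq, Prod.mk_eq_zero, not_and_or] at hx hy hz
  rw [Fintype.linearIndependent_iff]
  constructor
  · intro h hd
    have key : ∀ p q r : ℂ, p * a + q * c = 0 → p * b + r * e = 0 → q * d + r * f = 0 →
        p = 0 ∧ q = 0 ∧ r = 0 := by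
      intro p q r h1 h2 h3
      have := h ![p, q, r] (by simp [Fin.sum_univ_three, h1, h2, h3])
      exact ⟨this 0, this 1, this 2⟩
    simp only at hd
    obtain ⟨k1, k2, k3⟩ := key (-(c * e)) (a * e) (b * c) (by ring) (by ring) (by linear_combination hd)
    obtain ⟨k4, k5, k6⟩ := key (d * e) (b * f) (-(b * d)) (by linear_combination hd) (by ring) (by ring)
    obtain ⟨k7, k8, k9⟩ := key (-(c * f)) (a * f) (-(a * d)) (by ring)
      (by linear_combination -hd) (by ring)
    simp only [neg_eq_zero, mul_eq_zero] at *
    tauto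
  · intro hd g hg
    simp only [Fin.sum_univ_three, Matrix.cons_val, Prod.smul_mk, smul_eq_mul, Prod.mk_add_mk,
      Prod.mk_eq_zero, mul_zero, add_zero, zero_add] at hg
    obtain ⟨h1, h2, h3⟩ := hg
    simp only at hd
    have e0 : g 0 * (a * d * e + b * c * f) = 0 := by
      linear_combination d * e * h1 + c * f * h2 - c * e * h3
    have e1 : g 1 * (a * d * e + b * c * f) = 0 := by
      linear_combination b * f * h1 - a * f * h2 + a * e * h3
    have e2 : g 2 * (a * d * e + b * c * f) = 0 := by
      linear_combination -b * d * h1 + a * d * h2 + b * c * h3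
    intro i
    fin_cases i
    · exact (mul_eq_zero.1 e0).resolve_right hd
    · exact (mul_eq_zero.1 e1).resolve_right hd
    · exact (mul_eq_zero.1 e2).resolve_right hd

lemma dp_pair (T : Submodule ℂ (ℂ × ℂ × ℂ)) (u v : ℂ × ℂ × ℂ) (hu : u ∈ T) (hv : v ∈ T)
    (h : LinearIndependent ℂ ![u, v]) : 2 ≤ Module.finrank ℂ T := by
  have h1 := finrank_span_eq_card h
  have h2 : Submodule.span ℂ (Set.range ![u, v]) ≤ T := by
    rw [Submodule.span_le]
    rintro _ ⟨i, rfl⟩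
    fin_cases i <;> simpa
  have := Submodule.finrank_mono h2
  simp at h1
  omega

lemma dp_two_le (T : Submodule ℂ (ℂ × ℂ × ℂ)) (x y z : ℂ × ℂ)
    (hx : x ≠ 0) (hy : y ≠ 0) (hz : z ≠ 0)
    (hxT : ((x.1, x.2, 0) : ℂ × ℂ × ℂ) ∈ T) (hyT : ((y.1, 0, y.2) : ℂ × ℂ × ℂ) ∈ T)
    (hzT : ((0, z.1, z.2) : ℂ × ℂ × ℂ) ∈ T) : 2 ≤ Module.finrank ℂ T := by
  obtain ⟨a, b⟩ := x
  obtain ⟨c, d⟩ := y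
  obtain ⟨e, f⟩ := z
  simp only [ne_eq, Prod.mk_eq_zero, not_and_or] at hx hy hz hxT hyT hzT
  by_cases ha : a = 0
  · refine dp_pair T _ _ hxT hyT ?_
    rw [LinearIndependent.pair_iff]
    intro s t h
    simp only [Prod.smul_mk, smul_eq_mul, Prod.mk_add_mk, Prod.mk_eq_zero] at h
    grind
  · refine dp_pair T _ _ hxT hzT ?_
    rw [LinearIndependent.pair_iff]
    intro s t h
    simp only [Prod.smul_mk, smul_eq_mul, Prod.mk_add_mk, Prod.mk_eq_zero] at h
    grind

/-- The span of the three image vectors. -/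
def dpSpan (x y z : ℂ × ℂ) : Submodule ℂ (ℂ × ℂ × ℂ) :=
  Submodule.span ℂ (Set.range ![((x.1, x.2, 0) : ℂ × ℂ × ℂ), (y.1, 0, y.2), (0, z.1, z.2)])

lemma dpSpan_le (T : Submodule ℂ (ℂ × ℂ × ℂ)) (x y z : ℂ × ℂ)
    (hxT : ((x.1, x.2, 0) : ℂ × ℂ × ℂ) ∈ T) (hyT : ((y.1, 0, y.2) : ℂ × ℂ × ℂ) ∈ T)
    (hzT : ((0, z.1, z.2) : ℂ × ℂ × ℂ) ∈ T) : dpSpan x y z ≤ T := by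
  rw [dpSpan, Submodule.span_le]
  rintro _ ⟨i, rfl⟩
  fin_cases i <;> simpa

lemma dpSpan_mem (x y z : ℂ × ℂ) : ((x.1, x.2, 0) : ℂ × ℂ × ℂ) ∈ dpSpan x y z ∧
    ((y.1, 0, y.2) : ℂ × ℂ × ℂ) ∈ dpSpan x y z ∧ ((0, z.1, z.2) : ℂ × ℂ × ℂ) ∈ dpSpan x y z :=
  ⟨Submodule.subset_span ⟨0, rfl⟩, Submodule.subset_span ⟨1, rfl⟩, Submodule.subset_span ⟨2, rfl⟩⟩

lemma dpSpan_finrank (x y z : ℂ × ℂ) (hx : x ≠ 0) (hy : y ≠ 0) (hz : z ≠ 0)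
    (hd : x.1 * y.2 * z.1 + x.2 * y.1 * z.2 = 0) : Module.finrank ℂ (dpSpan x y z) = 2 := by
  obtain ⟨h1, h2, h3⟩ := dpSpan_mem x y z
  have hge := dp_two_le _ x y z hx hy hz h1 h2 h3
  have hle : Module.finrank ℂ (dpSpan x y z) ≤ 3 :=
    (finrank_range_le_card (R := ℂ)
      ![((x.1, x.2, 0) : ℂ × ℂ × ℂ), (y.1, 0, y.2), (0, z.1, z.2)]).trans (by simp)
  have hne : Module.finrank ℂ (dpSpan x y z) ≠ 3 := by
    intro h
    refine (dp_indep_iff x y z hx hy hz).1 ?_ hd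
    rw [linearIndependent_iff_card_eq_finrank_span]
    rw [Fintype.card_fin]
    exact h.symm
  omega

lemma dp_line (L : Submodule ℂ (ℂ × ℂ)) (h : Module.finrank ℂ L = 1) :
    ∃ v ∈ L, v ≠ 0 ∧ ∀ w ∈ L, ∃ c : ℂ, w = c • v := by
  obtain ⟨⟨v, hv⟩, h0, hw⟩ := finrank_eq_one_iff'.1 h
  refine ⟨v, hv, fun h => h0 (Subtype.ext h), fun w hwL => ?_⟩
  obtain ⟨c, hc⟩ := hw ⟨w, hwL⟩
  exact ⟨c, (congrArg Subtype.val hc).symm⟩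

lemma dp_cond (T : Submodule ℂ (ℂ × ℂ × ℂ)) (hT : Module.finrank ℂ T = 2) (x y z : ℂ × ℂ)
    (hx : x ≠ 0) (hy : y ≠ 0) (hz : z ≠ 0)
    (hxT : ((x.1, x.2, 0) : ℂ × ℂ × ℂ) ∈ T) (hyT : ((y.1, 0, y.2) : ℂ × ℂ × ℂ) ∈ T)
    (hzT : ((0, z.1, z.2) : ℂ × ℂ × ℂ) ∈ T) : x.1 * y.2 * z.1 + x.2 * y.1 * z.2 = 0 := by
  by_contra hd
  have h1 := finrank_span_eq_card ((dp_indep_iff x y z hx hy hz).2 hd)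
  have h2 := Submodule.finrank_mono (dpSpan_le T x y z hxT hyT hzT)
  rw [dpSpan, h1, hT] at h2
  simp at h2

lemma dp_eq (T : Submodule ℂ (ℂ × ℂ × ℂ)) (hT : Module.finrank ℂ T = 2) (x y z : ℂ × ℂ)
    (hx : x ≠ 0) (hy : y ≠ 0) (hz : z ≠ 0)
    (hxT : ((x.1, x.2, 0) : ℂ × ℂ × ℂ) ∈ T) (hyT : ((y.1, 0, y.2) : ℂ × ℂ × ℂ) ∈ T)
    (hzT : ((0, z.1, z.2) : ℂ × ℂ × ℂ) ∈ T) : dpSpan x y z = T :=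
  Submodule.eq_of_le_of_finrank_eq (dpSpan_le T x y z hxT hyT hzT)
    ((dpSpan_finrank x y z hx hy hz (dp_cond T hT x y z hx hy hz hxT hyT hzT)).trans hT.symm)

/-- del Pezzo example. Let `Q` be the `D₄` quiver with arrows
`ᾱ : x → t`, `η̄ : z → t`, `γ̄ : y → t` and `M` the representation with
`M_x = M_y = M_z = ℂ²`, `M_t = ℂ³`, `M_ᾱ(x₀,x₁) = (x₀,x₁,0)`, `M_η̄(z₀,z₁) = (0,z₀,z₁)`,
`M_γ̄(y₀,y₁) = (y₀,0,y₁)`. The map `N ↦ (N_x, N_y, N_z)` is a bijection from the set of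
subrepresentations `N` of `M` with `dim N_x = dim N_y = dim N_z = 1`, `dim N_t = 2` onto
the set of triples of lines `(L_x, L_y, L_z)` in `ℂ²` satisfying
`x₀·y₁·z₀ + x₁·y₀·z₁ = 0` for some (equivalently every) choice of nonzero vectors. -/
theorem d4_del_pezzo_bijection :
    Set.BijOn
      (fun N : Submodule ℂ (ℂ × ℂ) × Submodule ℂ (ℂ × ℂ) × Submodule ℂ (ℂ × ℂ) ×
          Submodule ℂ (ℂ × ℂ × ℂ) => (N.1, N.2.1, N.2.2.1))
      {N | (∀ v ∈ N.1, ((v.1, v.2, 0) : ℂ × ℂ × ℂ) ∈ N.2.2.2) ∧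
           (∀ v ∈ N.2.2.1, ((0, v.1, v.2) : ℂ × ℂ × ℂ) ∈ N.2.2.2) ∧
           (∀ v ∈ N.2.1, ((v.1, 0, v.2) : ℂ × ℂ × ℂ) ∈ N.2.2.2) ∧
           Module.finrank ℂ N.1 = 1 ∧ Module.finrank ℂ N.2.1 = 1 ∧
           Module.finrank ℂ N.2.2.1 = 1 ∧ Module.finrank ℂ N.2.2.2 = 2}
      {L : Submodule ℂ (ℂ × ℂ) × Submodule ℂ (ℂ × ℂ) × Submodule ℂ (ℂ × ℂ) |
        Module.finrank ℂ L.1 = 1 ∧ Module.finrank ℂ L.2.1 = 1 ∧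
        Module.finrank ℂ L.2.2 = 1 ∧ DelPezzoCond L.1 L.2.1 L.2.2} := by
  refine ⟨?_, ?_, ?_⟩
  · rintro ⟨A, B, C, T⟩ ⟨hA, hC, hB, fA, fB, fC, fT⟩
    refine ⟨fA, fB, fC, ?_⟩
    intro x hx y hy z hz x0 y0 z0
    exact dp_cond T fT x y z x0 y0 z0 (hA x hx) (hB y hy) (hC z hz)
  · rintro ⟨A, B, C, T⟩ ⟨hA, hC, hB, fA, fB, fC, fT⟩ ⟨A', B', C', T'⟩
      ⟨hA', hC', hB', fA', fB', fC', fT'⟩ h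
    simp only [Prod.mk.injEq] at h hA hB hC hA' hB' hC' fA fB fC fT fT' ⊢
    obtain ⟨rfl, rfl, rfl⟩ := h
    obtain ⟨x, hx, x0, -⟩ := dp_line _ fA
    obtain ⟨y, hy, y0, -⟩ := dp_line _ fB
    obtain ⟨z, hz, z0, -⟩ := dp_line _ fC
    refine ⟨rfl, rfl, rfl, ?_⟩
    rw [← dp_eq T fT x y z x0 y0 z0 (hA x hx) (hB y hy) (hC z hz),
      ← dp_eq T' fT' x y z x0 y0 z0 (hA' x hx) (hB' y hy) (hC' z hz)]
  · rintro ⟨A, B, C⟩ ⟨fA, fB, fC, hd⟩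
    obtain ⟨x, hx, x0, hA⟩ := dp_line _ fA
    obtain ⟨y, hy, y0, hB⟩ := dp_line _ fB
    obtain ⟨z, hz, z0, hC⟩ := dp_line _ fC
    obtain ⟨h1, h2, h3⟩ := dpSpan_mem x y z
    refine ⟨(A, B, C, dpSpan x y z), ⟨?_, ?_, ?_, fA, fB, fC, ?_⟩, rfl⟩
    · intro w hw
      obtain ⟨c, rfl⟩ := hA w hw
      simpa using Submodule.smul_mem _ c h1
    · intro w hw
      obtain ⟨c, rfl⟩ := hC w hw
      have h := Submodule.smul_mem _ c h3
      rwa [Prod.smul_mk, Prod.smul_mk, smul_zero] at h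
    · intro w hw
      obtain ⟨c, rfl⟩ := hB w hw
      simpa using Submodule.smul_mem _ c h2
    · exact dpSpan_finrank x y z x0 y0 z0 (hd x hx y hy z hz x0 y0 z0)
end

section
/- Let Q be a quiver and let X be a representation of Q with ordered basis B (i.e., X_p = ℂ^{B_p} and each arrow a carries a matrix X_a) whose coefficient quiver is a tree, meaning that the undirected graph on B with an edge {i, j} for each arrow (i, j) of each fibre F⁻¹(a) is connected and acyclic. Assume that for every arrow a ∈ Q₁ the linear map X_a is injective or surjective (i.e., has maximal rank). Then the following are equivalent: (i) the coefficient quiver is a weak polarization for X, i.e., for every a ∈ Q₁ there do not exist arrows (s₁, t₁), (s₂, t₁), (s₂, t₂) ∈ F⁻¹(a) with s₁ ≠ s₂ and t₁ ≠ t₂; (ii) for every a ∈ Q₁, either every i ∈ B_{s(a)} is the source of at most one arrow of F⁻¹(a), or every j ∈ B_{t(a)} is the target of at most one arrow of F⁻¹(a). -/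
attribute [local instance] Classical.propDecidable

section TreePolarization

variable {V A : Type} {n : ℕ}

/-- The set `B_p` of basis elements lying over the vertex `p`. -/
noncomputable def bAt' (vtx : Fin n → V) (p : V) : Finset (Fin n) :=
  Finset.univ.filter (fun i => vtx i = p)

/-- `(i, j)` is an arrow of the coefficient quiver in the fibre `F⁻¹(a)`:
the `(j, i)` entry of `X_a` is nonzero. -/
def IsArrow' (X : A → Fin n → Fin n → ℂ) (a : A) (i j : Fin n) : Prop := X a j i ≠ 0

/-- The underlying undirected graph of the coefficient quiver. -/
def coeffGraph' (X : A → Fin n → Fin n → ℂ) : SimpleGraph (Fin n) :=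
  SimpleGraph.fromRel (fun i j => ∃ a, IsArrow' X a i j)

/-- If the rows outside `S` vanish and two rows in `S` are proportional, the rank is `< |S|`. -/
theorem rank_lt_of_rows {n : ℕ} (M : Matrix (Fin n) (Fin n) ℂ) (S : Finset (Fin n))
    (hS : ∀ j, j ∉ S → M j = 0) (j₁ j₂ : Fin n) (hne : j₁ ≠ j₂) (h₁ : j₁ ∈ S) (h₂ : j₂ ∈ S)
    (c : ℂ) (hc : M j₁ = c • M j₂) : M.rank < S.card := by
  have hle : M.rank ≤ (S.erase j₁).card := by
    rw [Matrix.rank_eq_finrank_span_row]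
    have hsub : Submodule.span ℂ (Set.range M.row) ≤
        Submodule.span ℂ (((S.erase j₁).image M.row : Finset (Fin n → ℂ)) : Set (Fin n → ℂ)) := by
      have key : ∀ j, j ∈ S.erase j₁ → M j ∈ Submodule.span ℂ
          (((S.erase j₁).image M.row : Finset (Fin n → ℂ)) : Set (Fin n → ℂ)) := fun j hj =>
        Submodule.subset_span (Finset.mem_coe.2 (Finset.mem_image_of_mem M.row hj))
      rw [Submodule.span_le]
      rintro _ ⟨j, rfl⟩
      change M j ∈ Submodule.span ℂ _
      by_cases hj : j ∈ S
      · by_cases hj1 : j = j₁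
        · rw [hj1, hc]
          exact Submodule.smul_mem _ _ (key _ (Finset.mem_erase.2 ⟨hne.symm, h₂⟩))
        · exact key _ (Finset.mem_erase.2 ⟨hj1, hj⟩)
      · rw [hS j hj]
        exact Submodule.zero_mem _
    exact (Submodule.finrank_mono hsub).trans
      ((finrank_span_finset_le_card _).trans Finset.card_image_le)
  exact hle.trans_lt (Finset.card_erase_lt_of_mem h₁)

/-- Two rows with their only possible nonzero entry in the same column `i`. -/
theorem rank_lt_of_star {n : ℕ} (M : Matrix (Fin n) (Fin n) ℂ) (S : Finset (Fin n))
    (hS : ∀ j i, M j i ≠ 0 → j ∈ S) (i j₁ j₂ : Fin n) (hne : j₁ ≠ j₂)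
    (h₁ : M j₁ i ≠ 0) (h₂ : M j₂ i ≠ 0)
    (u₁ : ∀ k, M j₁ k ≠ 0 → k = i) (u₂ : ∀ k, M j₂ k ≠ 0 → k = i) : M.rank < S.card := by
  refine rank_lt_of_rows M S ?_ j₁ j₂ hne (hS _ _ h₁) (hS _ _ h₂) (M j₁ i / M j₂ i) ?_
  · intro j hj
    funext k
    by_contra h
    exact hj (hS j k h)
  · funext k
    by_cases hk : k = i
    · subst hk
      simp [h₂]
    · have e₁ : M j₁ k = 0 := by
        by_contra h
        exact hk (u₁ k h)
      have e₂ : M j₂ k = 0 := by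
        by_contra h
        exact hk (u₂ k h)
      simp [e₁, e₂]

/-- Lemma of the appendix. Let `X` be a tree module such that every
linear map `X_a` has maximal rank. Then the coefficient quiver is a weak polarization
(no subdiagram `s₁ → t₁ ← s₂ → t₂` within one fibre) if and only if for every arrow `a`,
either every basis vector over `s(a)` is the source of at most one arrow of `F⁻¹(a)`, or
every basis vector over `t(a)` is the target of at most one arrow of `F⁻¹(a)`. -/
theorem weak_polarization_iff_polarization {V A : Type} {n : ℕ}
    (src tgt : A → V) (vtx : Fin n → V) (X : A → Fin n → Fin n → ℂ)
    (hsupp : ∀ a i j, X a j i ≠ 0 → vtx i = src a ∧ vtx j = tgt a)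
    (htree : (coeffGraph' X).IsTree)
    (hrank : ∀ a : A, (Matrix.of fun j i => X a j i).rank
      = min (bAt' vtx (src a)).card (bAt' vtx (tgt a)).card) :
    (∀ a : A, ¬ ∃ s₁ t₁ s₂ t₂ : Fin n,
        IsArrow' X a s₁ t₁ ∧ IsArrow' X a s₂ t₁ ∧ IsArrow' X a s₂ t₂ ∧
        s₁ ≠ s₂ ∧ t₁ ≠ t₂) ↔
    (∀ a : A,
        (∀ i : Fin n, (Finset.univ.filter fun j => IsArrow' X a i j).card ≤ 1) ∨
        (∀ j : Fin n, (Finset.univ.filter fun i => IsArrow' X a i j).card ≤ 1)) := by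
  constructor
  · intro h a
    by_contra hcon
    push Not at hcon
    obtain ⟨⟨i, hi⟩, ⟨j, hj⟩⟩ := hcon
    obtain ⟨j₁, hj₁, j₂, hj₂, hjne⟩ := Finset.one_lt_card.1 hi
    obtain ⟨i₁, hi₁, i₂, hi₂, hine⟩ := Finset.one_lt_card.1 hj
    simp only [Finset.mem_filter, Finset.mem_univ, true_and] at hj₁ hj₂ hi₁ hi₂
    have w : ∀ s₁ t₁ s₂ t₂ : Fin n, IsArrow' X a s₁ t₁ → IsArrow' X a s₂ t₁ →
        IsArrow' X a s₂ t₂ → t₁ ≠ t₂ → s₁ = s₂ := by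
      intro s₁ t₁ s₂ t₂ a₁ a₂ a₃ hn
      by_contra hs
      exact h a ⟨s₁, t₁, s₂, t₂, a₁, a₂, a₃, hs, hn⟩
    have r₁ : (Matrix.of fun j i => X a j i).rank < (bAt' vtx (tgt a)).card := by
      refine rank_lt_of_star _ _ ?_ i j₁ j₂ hjne hj₁ hj₂ ?_ ?_
      · intro j i hji
        simpa [bAt'] using (hsupp a i j hji).2
      · intro k hk
        exact w k j₁ i j₂ hk hj₁ hj₂ hjne
      · intro k hk
        exact w k j₂ i j₁ hk hj₂ hj₁ hjne.symm
    have r₂ : (Matrix.of fun j i => X a j i).rank < (bAt' vtx (src a)).card := by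
      rw [← Matrix.rank_transpose]
      refine rank_lt_of_star _ _ ?_ j i₁ i₂ hine hi₁ hi₂ ?_ ?_
      · intro i j hji
        simpa [bAt'] using (hsupp a i j hji).1
      · intro k hk
        by_contra hkj
        exact hine (w i₂ j i₁ k hi₂ hi₁ hk (Ne.symm hkj)).symm
      · intro k hk
        by_contra hkj
        exact hine (w i₁ j i₂ k hi₁ hi₂ hk (Ne.symm hkj))
    have := hrank a
    omega
  · rintro h a ⟨s₁, t₁, s₂, t₂, a₁, a₂, a₃, hs, ht⟩
    rcases h a with h | h
    · exact absurd (h s₂) (not_le.2 (Finset.one_lt_card.2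
        ⟨t₁, by simpa using a₂, t₂, by simpa using a₃, ht⟩))
    · exact absurd (h t₁) (not_le.2 (Finset.one_lt_card.2
        ⟨s₁, by simpa using a₁, s₂, by simpa using a₂, hs⟩))

end TreePolarization
end
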